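/- Let π ∈ {4231, 4213, 4132, 4123}, let n ≥ 1 and S, T ⊆ [n]. Define f₁(S) = a₁a₂…a_{2n} by (a_{2i−1}, a_{2i}) = (4(i−1)+π(1), 4(i−1)+π(2)) if i ∈ S and (a_{2i−1}, a_{2i}) = (4(i−1)+π(2), 4(i−1)+π(1)) otherwise. Let d(i) = i if π = 4231 and d(i) = n+1−i otherwise, and define g₁(T) = b₁b₂…b_{2n} by (b_{2i−1}, b_{2i}) = (4(d(i)−1)+π(3), 4(d(i)−1)+π(4)) if d(i) ∈ T and (b_{2i−1}, b_{2i}) = (4(d(i)−1)+π(4), 4(d(i)−1)+π(3)) otherwise. Then τ = f₁(S)g₁(T) is a permutation of [4n], and τ contains π if and only if S ∩ T ≠ ∅. -/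

import Mathlib

/-- `Contains τ π`: the sequence `τ` contains the pattern `π`, i.e. some subsequence of `τ`
is order-isomorphic to `π`. -/
def Contains (τ π : List ℕ) : Prop :=
  ∃ f : Fin π.length → Fin τ.length, StrictMono f ∧
    ∀ j l : Fin π.length, (τ.get (f j) < τ.get (f l) ↔ π.get j < π.get l)

/-- The increasing pattern `1 2 … k`. -/
def IncPattern (k : ℕ) : List ℕ := List.range' 1 k

/-- The decreasing pattern `k (k-1) … 1`. -/
def DecPattern (k : ℕ) : List ℕ := (List.range' 1 k).reverse

/-- A pattern is a permutation of `[k] = {1,…,k}` where `k` is its length. -/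
def IsPattern (π : List ℕ) : Prop := π.Perm (List.range' 1 π.length)

/-- `τ` is a permutation of `[n] = {1,…,n}`. -/
def IsPermOf (n : ℕ) (τ : List ℕ) : Prop := τ.Perm (List.range' 1 n)

/-- `τ` is a sequence of pairwise distinct values from `[n]`. -/
def IsDistinctSeqIn (n : ℕ) (τ : List ℕ) : Prop :=
  τ.Nodup ∧ ∀ x ∈ τ, 1 ≤ x ∧ x ≤ n

/-- A deterministic single-pass streaming algorithm with state set `Q`:
initial state, accepting states, transition function. -/
structure StreamAlg (Q : Type) where
  q0 : Q
  F : Set Q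
  t : Q → ℕ → Q

/-- The state reached by the algorithm after reading the input `τ`. -/
def StreamAlg.run {Q : Type} (A : StreamAlg Q) (τ : List ℕ) : Q :=
  τ.foldl A.t A.q0

/-- The algorithm accepts the input `τ`. -/
def StreamAlg.Accepts {Q : Type} (A : StreamAlg Q) (τ : List ℕ) : Prop :=
  A.run τ ∈ A.F

/-- `A` solves `π`-PPM_n : it accepts a permutation `τ` of `[n]` iff `τ` contains `π`. -/
def SolvesPPM {Q : Type} (A : StreamAlg Q) (n : ℕ) (π : List ℕ) : Prop :=
  ∀ τ : List ℕ, IsPermOf n τ → (A.Accepts τ ↔ Contains τ π)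

/-- `A` solves `π`-SequencePPM_n : it accepts a sequence `τ` of pairwise distinct values
from `[n]` iff `τ` contains `π`. -/
def SolvesSeqPPM {Q : Type} (A : StreamAlg Q) (n : ℕ) (π : List ℕ) : Prop :=
  ∀ τ : List ℕ, IsDistinctSeqIn n τ → (A.Accepts τ ↔ Contains τ π)

/-- `π(j)` for a pattern given as a list (1-indexed). -/
def pval (π : List ℕ) (j : ℕ) : ℕ := π.getD (j - 1) 0

/-- `f₁(S) = a₁…a_{2n}` with `(a_{2i−1}, a_{2i}) = (4(i−1)+π(1), 4(i−1)+π(2))` if `i ∈ S`,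
and the two values swapped otherwise. -/
def fOne (n : ℕ) (π : List ℕ) (S : Finset ℕ) : List ℕ :=
  (List.range' 1 n).flatMap (fun i =>
    if i ∈ S then [4 * (i - 1) + pval π 1, 4 * (i - 1) + pval π 2]
    else [4 * (i - 1) + pval π 2, 4 * (i - 1) + pval π 1])

/-- `d(i) = i` if `π = 4231`, and `d(i) = n+1−i` otherwise. -/
def dFun (n : ℕ) (π : List ℕ) (i : ℕ) : ℕ :=
  if π = [4, 2, 3, 1] then i else n + 1 - i

/-- `g₁(T) = b₁…b_{2n}` with `(b_{2i−1}, b_{2i}) = (4(d(i)−1)+π(3), 4(d(i)−1)+π(4))` if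
`d(i) ∈ T`, and the two values swapped otherwise. -/
def gOne (n : ℕ) (π : List ℕ) (T : Finset ℕ) : List ℕ :=
  (List.range' 1 n).flatMap (fun i =>
    if dFun n π i ∈ T then
      [4 * (dFun n π i - 1) + pval π 3, 4 * (dFun n π i - 1) + pval π 4]
    else
      [4 * (dFun n π i - 1) + pval π 4, 4 * (dFun n π i - 1) + pval π 3])

theorem getElem_flatMap_range'_pair (a b : ℕ → ℕ) (n s k : ℕ)
    (hk : k < ((List.range' s n).flatMap fun i => [a i, b i]).length) :
    ((List.range' s n).flatMap fun i => [a i, b i])[k] =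
      if k % 2 = 0 then a (s + k / 2) else b (s + k / 2) := by
  induction n generalizing s k with
  | zero => simp at hk
  | succ n ih =>
    match k with
    | 0 => simp [List.range'_succ]
    | 1 => simp [List.range'_succ]
    | k + 2 =>
      have hk' : k < ((List.range' (s + 1) n).flatMap fun i => [a i, b i]).length := by
        simp [List.range'_succ] at hk ⊢
        omega
      have h := ih (s + 1) k hk'
      have e1 : (k + 2) % 2 = k % 2 := by omega
      have e2 : s + (k + 2) / 2 = s + 1 + k / 2 := by omega
      simp only [List.range'_succ, List.flatMap_cons, List.cons_append, List.nil_append,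
        List.getElem_cons_succ, e1, e2]
      exact h

theorem fOne_eq_flatMap_pair (n : ℕ) (π : List ℕ) (S : Finset ℕ) :
    fOne n π S = (List.range' 1 n).flatMap fun i =>
      [4 * (i - 1) + if i ∈ S then pval π 1 else pval π 2,
        4 * (i - 1) + if i ∈ S then pval π 2 else pval π 1] := by
  unfold fOne
  congr 1
  funext i
  split_ifs <;> rfl

theorem gOne_eq_flatMap_pair (n : ℕ) (π : List ℕ) (T : Finset ℕ) :
    gOne n π T = (List.range' 1 n).flatMap fun i =>
      [4 * (dFun n π i - 1) + if dFun n π i ∈ T then pval π 3 else pval π 4,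
        4 * (dFun n π i - 1) + if dFun n π i ∈ T then pval π 4 else pval π 3] := by
  unfold gOne
  congr 1
  funext i
  split_ifs <;> rfl

theorem length_fOne (n : ℕ) (π : List ℕ) (S : Finset ℕ) : (fOne n π S).length = 2 * n := by
  simp [fOne_eq_flatMap_pair, mul_comm]

theorem length_gOne (n : ℕ) (π : List ℕ) (T : Finset ℕ) : (gOne n π T).length = 2 * n := by
  simp [gOne_eq_flatMap_pair, mul_comm]

theorem getElem_fOne (n : ℕ) (π : List ℕ) (S : Finset ℕ) (k : ℕ)
    (hk : k < (fOne n π S).length) :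
    (fOne n π S)[k] =
      4 * (k / 2) + if (k % 2 = 0 ↔ k / 2 + 1 ∈ S) then pval π 1 else pval π 2 := by
  simp only [fOne_eq_flatMap_pair, getElem_flatMap_range'_pair, Nat.add_comm 1,
    Nat.add_sub_cancel]
  by_cases h₁ : k % 2 = 0 <;> by_cases h₂ : k / 2 + 1 ∈ S <;> simp [h₁, h₂]

theorem getElem_gOne (n : ℕ) (π : List ℕ) (T : Finset ℕ) (k : ℕ)
    (hk : k < (gOne n π T).length) :
    (gOne n π T)[k] = 4 * (dFun n π (k / 2 + 1) - 1) +
      if (k % 2 = 0 ↔ dFun n π (k / 2 + 1) ∈ T) then pval π 3 else pval π 4 := by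
  simp only [gOne_eq_flatMap_pair, getElem_flatMap_range'_pair, Nat.add_comm 1]
  by_cases h₁ : k % 2 = 0 <;> by_cases h₂ : dFun n π (k / 2 + 1) ∈ T <;> simp [h₁, h₂]

theorem dFun_mem_range' {n : ℕ} (π : List ℕ) {i : ℕ} (hi : 1 ≤ i ∧ i ≤ n) :
    dFun n π i ∈ List.range' 1 n := by
  rw [List.mem_range'_1]
  unfold dFun
  split_ifs <;> omega

theorem dFun_dFun {n : ℕ} (π : List ℕ) {i : ℕ} (hi : i ≤ n) :
    dFun n π (dFun n π i) = i := by
  unfold dFun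
  split_ifs <;> omega

theorem mem_fOne {n : ℕ} {π : List ℕ} {S : Finset ℕ} {x i : ℕ} (hi : 1 ≤ i ∧ i ≤ n)
    (hx : x = 4 * (i - 1) + pval π 1 ∨ x = 4 * (i - 1) + pval π 2) : x ∈ fOne n π S := by
  refine List.mem_flatMap.2 ⟨i, List.mem_range'_1.2 (by omega), ?_⟩
  split_ifs <;> simp <;> tauto

theorem mem_gOne {n : ℕ} {π : List ℕ} {T : Finset ℕ} {x i : ℕ} (hi : 1 ≤ i ∧ i ≤ n)
    (hx : x = 4 * (i - 1) + pval π 3 ∨ x = 4 * (i - 1) + pval π 4) : x ∈ gOne n π T := by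
  refine List.mem_flatMap.2 ⟨dFun n π i, dFun_mem_range' π hi, ?_⟩
  rw [dFun_dFun π hi.2]
  split_ifs <;> simp <;> tauto

theorem isPermOf_fOne_append_gOne {π : List ℕ}
    (hπ : ∀ r, 1 ≤ r → r ≤ 4 → r = pval π 1 ∨ r = pval π 2 ∨ r = pval π 3 ∨ r = pval π 4)
    (n : ℕ) (S T : Finset ℕ) : IsPermOf (4 * n) (fOne n π S ++ gOne n π T) := by
  have hsub : List.range' 1 (4 * n) ⊆ fOne n π S ++ gOne n π T := by
    intro x hx
    rw [List.mem_range'_1] at hx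
    have hi : 1 ≤ (x - 1) / 4 + 1 ∧ (x - 1) / 4 + 1 ≤ n := by omega
    rw [List.mem_append]
    rcases hπ ((x - 1) % 4 + 1) (by omega) (by omega) with h | h | h | h
    · exact Or.inl (mem_fOne hi (by omega))
    · exact Or.inl (mem_fOne hi (by omega))
    · exact Or.inr (mem_gOne hi (by omega))
    · exact Or.inr (mem_gOne hi (by omega))
  refine (((List.nodup_range' (s := 1) (n := 4 * n)).subperm hsub).perm_of_length_le ?_).symm
  simp [length_fOne, length_gOne]
  omega

theorem sublist_flatMap_of_mem {α β : Type*} {f : α → List β} {l : List α} {a : α}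
    (h : a ∈ l) : (f a).Sublist (l.flatMap f) := by
  rw [List.flatMap_def]
  exact List.sublist_flatten_of_mem (List.mem_map_of_mem h)

theorem pair_sublist_fOne {n : ℕ} (π : List ℕ) {S : Finset ℕ} {i : ℕ} (hi : 1 ≤ i ∧ i ≤ n)
    (hS : i ∈ S) :
    [4 * (i - 1) + pval π 1, 4 * (i - 1) + pval π 2].Sublist (fOne n π S) := by
  have h := sublist_flatMap_of_mem (f := fun i =>
    if i ∈ S then [4 * (i - 1) + pval π 1, 4 * (i - 1) + pval π 2]
    else [4 * (i - 1) + pval π 2, 4 * (i - 1) + pval π 1])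
    (List.mem_range'_1.2 (by omega) : i ∈ List.range' 1 n)
  rwa [if_pos hS] at h

theorem pair_sublist_gOne {n : ℕ} (π : List ℕ) {T : Finset ℕ} {i : ℕ} (hi : 1 ≤ i ∧ i ≤ n)
    (hT : i ∈ T) :
    [4 * (i - 1) + pval π 3, 4 * (i - 1) + pval π 4].Sublist (gOne n π T) := by
  have h := sublist_flatMap_of_mem (f := fun i =>
    if dFun n π i ∈ T then
      [4 * (dFun n π i - 1) + pval π 3, 4 * (dFun n π i - 1) + pval π 4]
    else
      [4 * (dFun n π i - 1) + pval π 4, 4 * (dFun n π i - 1) + pval π 3])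
    (dFun_mem_range' π hi)
  rwa [dFun_dFun π hi.2, if_pos hT] at h

theorem Contains.of_map_add_sublist {τ π : List ℕ} {c : ℕ}
    (h : (π.map (c + ·)).Sublist τ) : Contains τ π := by
  obtain ⟨f, hf⟩ := List.sublist_iff_exists_fin_orderEmbedding_get_eq.1 h
  have hlen : π.length = (π.map (c + ·)).length := by simp
  refine ⟨fun j => f (Fin.cast hlen j), fun j l hjl => f.strictMono hjl, fun j l => ?_⟩
  rw [← hf, ← hf]
  simp

theorem Contains.exists_getElem {τ : List ℕ} {a b c d : ℕ} (h : Contains τ [a, b, c, d]) :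
    ∃ (p q r s : ℕ) (_ : p < q) (_ : q < r) (_ : r < s) (_ : s < τ.length),
      (τ[q] < τ[p] ↔ b < a) ∧ (τ[r] < τ[p] ↔ c < a) ∧ (τ[q] < τ[r] ↔ b < c) ∧
      (τ[q] < τ[s] ↔ b < d) ∧ (τ[s] < τ[q] ↔ d < b) ∧
      (τ[r] < τ[s] ↔ c < d) ∧ (τ[s] < τ[r] ↔ d < c) := by
  obtain ⟨f, hf, h⟩ := h
  exact ⟨f 0, f 1, f 2, f 3, hf (by decide : (0 : Fin 4) < 1),
    hf (by decide : (1 : Fin 4) < 2), hf (by decide : (2 : Fin 4) < 3), (f 3).2,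
    h 1 0, h 2 0, h 1 2, h 1 3, h 3 1, h 2 3, h 3 2⟩

/-- A descent of `fOne` lies inside a single block, indexed by an element of `S`. -/
theorem fOne_descent {n : ℕ} {π : List ℕ} {S : Finset ℕ} (h₁ : pval π 1 = 4)
    (h₂ : 1 ≤ pval π 2 ∧ pval π 2 < 4) {p q : ℕ} (hpq : p < q) (hq : q < (fOne n π S).length)
    (h : (fOne n π S)[q] < (fOne n π S)[p]) :
    q = p + 1 ∧ p / 2 + 1 ∈ S ∧ (fOne n π S)[p] = 4 * (p / 2) + 4 ∧
      (fOne n π S)[q] = 4 * (p / 2) + pval π 2 := by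
  simp only [getElem_fOne, h₁] at h ⊢
  have hb : p / 2 = q / 2 := by
    split_ifs at h <;> omega
  have hp : p % 2 = 0 := by omega
  have hq' : q % 2 = 1 := by omega
  by_cases hS : p / 2 + 1 ∈ S
  · simp [← hb, hp, hq', hS]
    omega
  · simp [← hb, hp, hq', hS] at h
    omega

/-- A descent of `gOne` (for the pattern `4231`) or an ascent of `gOne` (for the other
patterns) lies inside a single block. -/
theorem gOne_same_block {n : ℕ} {π : List ℕ} {T : Finset ℕ}
    (h₃ : 1 ≤ pval π 3 ∧ pval π 3 < 4) (h₄ : 1 ≤ pval π 4 ∧ pval π 4 < 4)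
    {p q : ℕ} (hpq : p < q) (hq : q < (gOne n π T).length)
    (h : if π = [4, 2, 3, 1] then (gOne n π T)[q] < (gOne n π T)[p]
      else (gOne n π T)[p] < (gOne n π T)[q]) : p / 2 = q / 2 := by
  have hl := length_gOne n π T
  simp only [getElem_gOne, dFun] at h
  split_ifs at h <;> omega

theorem gOne_block {n : ℕ} {π : List ℕ} {T : Finset ℕ} {p q : ℕ} (hpq : p < q)
    (hq : q < (gOne n π T).length) (hb : p / 2 = q / 2) :
    ∃ i, 1 ≤ i ∧
      (i ∈ T ∧ (gOne n π T)[p] = 4 * (i - 1) + pval π 3 ∧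
          (gOne n π T)[q] = 4 * (i - 1) + pval π 4 ∨
        i ∉ T ∧ (gOne n π T)[p] = 4 * (i - 1) + pval π 4 ∧
          (gOne n π T)[q] = 4 * (i - 1) + pval π 3) := by
  have hl := length_gOne n π T
  have hp : p % 2 = 0 := by omega
  have hq' : q % 2 = 1 := by omega
  refine ⟨dFun n π (p / 2 + 1), ?_, ?_⟩
  · unfold dFun
    split_ifs <;> omega
  · by_cases hT : dFun n π (p / 2 + 1) ∈ T <;> simp [getElem_gOne, ← hb, hp, hq', hT]

theorem nonempty_inter_of_contains {π : List ℕ}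
    (hπ : π = [4, 2, 3, 1] ∨ π = [4, 2, 1, 3] ∨ π = [4, 1, 3, 2] ∨ π = [4, 1, 2, 3])
    {n : ℕ} {S T : Finset ℕ} (h : Contains (fOne n π S ++ gOne n π T) π) :
    (S ∩ T).Nonempty := by
  have hF := length_fOne n π S
  have hG := length_gOne n π T
  have h₁ : pval π 1 = 4 := by rcases hπ with rfl | rfl | rfl | rfl <;> rfl
  have h₂ : 1 ≤ pval π 2 ∧ pval π 2 < 4 := by
    rcases hπ with rfl | rfl | rfl | rfl <;> decide
  have h₃ : 1 ≤ pval π 3 ∧ pval π 3 < 4 := by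
    rcases hπ with rfl | rfl | rfl | rfl <;> decide
  have h₄ : 1 ≤ pval π 4 ∧ pval π 4 < 4 := by
    rcases hπ with rfl | rfl | rfl | rfl <;> decide
  obtain ⟨p, q, r, s, hpq, hqr, hrs, hs, hqp, hrp, hqr', hqs, hsq, hrs', hsr⟩ :=
    (show Contains (fOne n π S ++ gOne n π T) [pval π 1, pval π 2, pval π 3, pval π 4] by
      rcases hπ with rfl | rfl | rfl | rfl <;> exact h).exists_getElem
  have hs' : s - 2 * n < (gOne n π T).length := by
    rw [List.length_append] at hs
    omega
  simp only [List.getElem_append, hF] at hqp hrp hqr' hqs hsq hrs' hsr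
  have hq : q < 2 * n := by
    by_contra hq
    simp only [dif_neg hq, dif_neg (show ¬ s < 2 * n by omega)] at hqs hsq
    have hb := gOne_same_block h₃ h₄ (show q - 2 * n < s - 2 * n by omega) hs' (by
      split_ifs with h0
      · exact hsq.2 (by subst h0; decide)
      · exact hqs.2 (by rcases hπ with rfl | rfl | rfl | rfl <;> first | contradiction | decide))
    omega
  have hr : ¬ r < 2 * n := by
    intro hr
    simp only [dif_pos hr, dif_pos (show p < 2 * n by omega)] at hrp
    have h₁₃ := fOne_descent h₁ h₂ (hpq.trans hqr) (by omega) (hrp.2 (by omega))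
    omega
  simp only [dif_pos hq, dif_neg hr, dif_pos (show p < 2 * n by omega),
    dif_neg (show ¬ s < 2 * n by omega)] at hqp hrp hqr' hqs hsq hrs' hsr
  obtain ⟨-, hS, hp, hq'⟩ := fOne_descent h₁ h₂ hpq (by omega) (hqp.2 (by omega))
  rw [hp] at hrp
  rw [hp, hq'] at hqp
  rw [hq'] at hqr' hqs hsq
  have hb : (r - 2 * n) / 2 = (s - 2 * n) / 2 := by
    by_cases h0 : π = [4, 1, 3, 2]
    · subst h0
      simp only [getElem_gOne] at hrp hqr' hqs hsr
      simp [dFun, pval] at hrp hqr' hqs hsr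
      split_ifs at hrp hqr' hqs hsr <;> omega
    · refine gOne_same_block h₃ h₄ (by omega) hs' ?_
      split_ifs with h1
      · exact hsr.2 (by subst h1; decide)
      · exact hrs'.2 (by rcases hπ with rfl | rfl | rfl | rfl <;> first | contradiction | decide)
  have h₃₄ : pval π 3 ≠ pval π 4 ∧ (pval π 2 < pval π 3 ∨ pval π 2 < pval π 4) := by
    rcases hπ with rfl | rfl | rfl | rfl <;> decide
  obtain ⟨i, hi, ⟨hT, hx, hy⟩ | ⟨-, hx, hy⟩⟩ :=
    gOne_block (show r - 2 * n < s - 2 * n by omega) hs' hb <;>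
    rw [hx] at hrp hqr' hrs' hsr <;> rw [hy] at hqs hrs' hsr
  · obtain rfl : i = p / 2 + 1 := by omega
    exact ⟨_, Finset.mem_inter.2 ⟨hS, hT⟩⟩
  · omega

/-- For `π ∈ {4231, 4213, 4132, 4123}`, `n ≥ 1`, and `S, T ⊆ [n]`, the sequence
`τ = f₁(S)g₁(T)` is a permutation of `[4n]`, and `τ` contains `π` iff `S ∩ T ≠ ∅`. -/
theorem stmt12 (π : List ℕ)
    (hπ : π = [4, 2, 3, 1] ∨ π = [4, 2, 1, 3] ∨ π = [4, 1, 3, 2] ∨ π = [4, 1, 2, 3])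
    (n : ℕ) (hn : 1 ≤ n) (S T : Finset ℕ)
    (hS : S ⊆ Finset.Icc 1 n) (hT : T ⊆ Finset.Icc 1 n) :
    IsPermOf (4 * n) (fOne n π S ++ gOne n π T) ∧
    (Contains (fOne n π S ++ gOne n π T) π ↔ (S ∩ T).Nonempty) := by
  refine ⟨isPermOf_fOne_append_gOne ?_ n S T, nonempty_inter_of_contains hπ, ?_⟩
  · rcases hπ with rfl | rfl | rfl | rfl <;> intro r h₁ h₄ <;> interval_cases r <;> decide
  · rintro ⟨i, hi⟩
    rw [Finset.mem_inter] at hi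
    have hin := Finset.mem_Icc.1 (hS hi.1)
    have h := (pair_sublist_fOne π hin hi.1).append (pair_sublist_gOne π hin hi.2)
    refine Contains.of_map_add_sublist (c := 4 * (i - 1)) ?_
    rcases hπ with rfl | rfl | rfl | rfl <;> exact h
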